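/- Let K be an algebraically closed field of characteristic zero and A = K⟨v1,v2,v3⟩ the free associative K-algebra. Let α1, α2, α̃3, β1, β2, β̃3 ∈ {0,1} ⊆ K satisfy α1α2 + α2β̃3 − α1β̃3 − α2 = 0 and β1β2 + β2α̃3 − β1α̃3 − β2 = 0. Then every K-linear map ⟪-,-⟫ : A⊗A → A⊗A satisfying the Leibniz rules with ⟪v_i,v_i⟫ = 0 for i = 1,2,3, ⟪v1,v2⟫ = α̃3·(v1⊗v2) − β̃3·(v2⊗v1), ⟪v2,v1⟫ = (−1+β̃3)·(v1⊗v2) + (1−α̃3)·(v2⊗v1), ⟪v1,v3⟫ = α2·(1⊗(v1v3)) − β2·((v3v1)⊗1), ⟪v3,v1⟫ = (−1+β2)·(1⊗(v3v1)) + (1−α2)·((v1v3)⊗1), ⟪v2,v3⟫ = α1·(1⊗(v2v3)) − β1·((v3v2)⊗1), ⟪v3,v2⟫ = (−1+β1)·(1⊗(v3v2)) + (1−α1)·((v2v3)⊗1), is a mixed double Poisson algebra structure on A of weight (1,1,−1). -/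

import Mathlib

open TensorProduct

noncomputable section

variable (K : Type*) [Field K]
variable (A : Type*) [Ring A] [Algebra K A]

/-- Leibniz rules for a double-bracket-type operation. -/
def LeibnizRules (D : A ⊗[K] A →ₗ[K] A ⊗[K] A) : Prop :=
  (∀ a b c : A,
      D (a ⊗ₜ[K] (b * c)) =
        (b ⊗ₜ[K] (1 : A)) * D (a ⊗ₜ[K] c) + D (a ⊗ₜ[K] b) * ((1 : A) ⊗ₜ[K] c))
  ∧ (∀ a b c : A,
      D ((a * b) ⊗ₜ[K] c) =
        ((1 : A) ⊗ₜ[K] a) * D (b ⊗ₜ[K] c) + D (a ⊗ₜ[K] c) * (b ⊗ₜ[K] (1 : A)))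

/-- The associated bracket `{a,b} = m(⟪a,b⟫)`. -/
def br (D : A ⊗[K] A →ₗ[K] A ⊗[K] A) (a b : A) : A :=
  LinearMap.mul' K A (D (a ⊗ₜ[K] b))

/-- The K-span of commutators `[A,A]`. -/
def commutatorSpan : Submodule K A :=
  Submodule.span K {x : A | ∃ a b : A, x = a * b - b * a}

/-- The flip on `A ⊗ A`. -/
def flipT : A ⊗[K] A →ₗ[K] A ⊗[K] A := (TensorProduct.comm K A A).toLinearMap

/-- Swap of the last two tensor factors of `(A ⊗ A) ⊗ A`. -/
def swap23 : ((A ⊗[K] A) ⊗[K] A) →ₗ[K] ((A ⊗[K] A) ⊗[K] A) :=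
  (TensorProduct.assoc K A A A).symm.toLinearMap ∘ₗ
    (LinearMap.lTensor A (TensorProduct.comm K A A).toLinearMap) ∘ₗ
    (TensorProduct.assoc K A A A).toLinearMap

/-- `⟪a, -⟫_L` on double tensors: `b ⊗ c ↦ ⟪a,b⟫ ⊗ c`. -/
def dL (D : A ⊗[K] A →ₗ[K] A ⊗[K] A) (a : A) :
    A ⊗[K] A →ₗ[K] (A ⊗[K] A) ⊗[K] A :=
  LinearMap.rTensor A (D ∘ₗ TensorProduct.mk K A A a)

/-- `⟪a, -⟫_R` on double tensors: `b ⊗ c ↦ b ⊗ ⟪a,c⟫`. -/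
def dR (D : A ⊗[K] A →ₗ[K] A ⊗[K] A) (a : A) :
    A ⊗[K] A →ₗ[K] (A ⊗[K] A) ⊗[K] A :=
  (TensorProduct.assoc K A A A).symm.toLinearMap ∘ₗ
    LinearMap.lTensor A (D ∘ₗ TensorProduct.mk K A A a)

/-- `⟪-, c⟫_L` on double tensors: `b ⊗ b' ↦ ⟪b,c⟫' ⊗ b' ⊗ ⟪b,c⟫''`. -/
def dLfst (D : A ⊗[K] A →ₗ[K] A ⊗[K] A) (c : A) :
    A ⊗[K] A →ₗ[K] (A ⊗[K] A) ⊗[K] A :=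
  swap23 K A ∘ₗ LinearMap.rTensor A (D ∘ₗ (TensorProduct.mk K A A).flip c)

/-- The double Jacobiator. -/
def DJac (D : A ⊗[K] A →ₗ[K] A ⊗[K] A) (a b c : A) : (A ⊗[K] A) ⊗[K] A :=
  dL K A D a (D (b ⊗ₜ[K] c)) - dR K A D b (D (a ⊗ₜ[K] c)) - dLfst K A D c (D (a ⊗ₜ[K] b))

/-- `c ⊗₁ (-)` : `w' ⊗ w'' ↦ w' ⊗ c ⊗ w''`. -/
def otimes1 (c : A) : A ⊗[K] A →ₗ[K] (A ⊗[K] A) ⊗[K] A :=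
  LinearMap.rTensor A ((TensorProduct.mk K A A).flip c)

variable {ι : Type*}

/-- Mixed double algebra structure of weight `lam` with respect to the generators `v`. -/
def IsMixedDouble (v : ι → A) (lam : ι → K) (D : A ⊗[K] A →ₗ[K] A ⊗[K] A) : Prop :=
  LeibnizRules K A D ∧
  ∀ i j : ι,
    D (v i ⊗ₜ[K] v j) + flipT K A (D (v j ⊗ₜ[K] v i)) =
      ((lam i + lam j) / 2) • (v i ⊗ₜ[K] v j - v j ⊗ₜ[K] v i) +
      ((lam i - lam j) / 2) • ((1 : A) ⊗ₜ[K] (v i * v j) - (v j * v i) ⊗ₜ[K] (1 : A))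

/-- Mixed double Poisson algebra structure of weight `lam` w.r.t. the generators `v`. -/
def IsMixedDoublePoisson (v : ι → A) (lam : ι → K) (D : A ⊗[K] A →ₗ[K] A ⊗[K] A) : Prop :=
  IsMixedDouble K A v lam D ∧
  ∀ i j k : ι,
    DJac K A D (v i) (v j) (v k) =
      (-((lam i + lam j) / 2)) • otimes1 K A (v j) (D (v i ⊗ₜ[K] v k)) +
      ((lam i - lam j) / 2) •
        otimes1 K A (1 : A) (((1 : A) ⊗ₜ[K] v j) * D (v i ⊗ₜ[K] v k))

/-- Modified double Poisson bracket. -/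
def IsModifiedDoublePoisson (D : A ⊗[K] A →ₗ[K] A ⊗[K] A) : Prop :=
  LeibnizRules K A D ∧
  (∀ a b : A, br K A D a b + br K A D b a ∈ commutatorSpan K A) ∧
  (∀ a b c : A,
    br K A D a (br K A D b c) - br K A D b (br K A D a c) - br K A D (br K A D a b) c = 0)

end


section helpers

variable {K : Type*} [Field K] {A : Type*} [Ring A] [Algebra K A]

theorem dL_tmul (D : A ⊗[K] A →ₗ[K] A ⊗[K] A) (a b c : A) :
    dL K A D a (b ⊗ₜ[K] c) = D (a ⊗ₜ[K] b) ⊗ₜ[K] c := by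
  simp [dL]

theorem dR_tmul (D : A ⊗[K] A →ₗ[K] A ⊗[K] A) (a b c : A) :
    dR K A D a (b ⊗ₜ[K] c) =
      (TensorProduct.assoc K A A A).symm (b ⊗ₜ[K] D (a ⊗ₜ[K] c)) := by
  simp [dR]

theorem dLfst_tmul (D : A ⊗[K] A →ₗ[K] A ⊗[K] A) (a b c : A) :
    dLfst K A D c (a ⊗ₜ[K] b) = swap23 K A (D (a ⊗ₜ[K] c) ⊗ₜ[K] b) := by
  simp [dLfst]

theorem swap23_tmul (a b c : A) :
    swap23 K A ((a ⊗ₜ[K] b) ⊗ₜ[K] c) = (a ⊗ₜ[K] c) ⊗ₜ[K] b := by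
  simp [swap23]

theorem otimes1_tmul (a b c : A) :
    otimes1 K A c (a ⊗ₜ[K] b) = (a ⊗ₜ[K] c) ⊗ₜ[K] b := by
  simp [otimes1]

theorem flipT_tmul (a b : A) : flipT K A (a ⊗ₜ[K] b) = b ⊗ₜ[K] a := by
  simp [flipT]

theorem leibniz_right_one {D : A ⊗[K] A →ₗ[K] A ⊗[K] A} (hL : LeibnizRules K A D) (a : A) :
    D (a ⊗ₜ[K] (1 : A)) = 0 := by
  have h := hL.1 a 1 1
  rw [← Algebra.TensorProduct.one_def, one_mul, mul_one, one_mul] at h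
  exact left_eq_add.mp h

theorem leibniz_left_one {D : A ⊗[K] A →ₗ[K] A ⊗[K] A} (hL : LeibnizRules K A D) (a : A) :
    D ((1 : A) ⊗ₜ[K] a) = 0 := by
  have h := hL.2 1 1 a
  rw [← Algebra.TensorProduct.one_def, one_mul, mul_one, one_mul] at h
  exact left_eq_add.mp h

theorem idem_of_zero_or_one {a : K} (h : a = 0 ∨ a = 1) : a * a = a := by
  rcases h with h | h <;> simp [h]

end helpers

set_option maxHeartbeats 4000000

theorem stmt15 {K : Type*} [Field K] [IsAlgClosed K] [CharZero K]
    (a1 a2 ta3 b1 b2 tb3 : K)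
    (ha1 : a1 = 0 ∨ a1 = 1)
    (ha2 : a2 = 0 ∨ a2 = 1)
    (hta3 : ta3 = 0 ∨ ta3 = 1)
    (hb1 : b1 = 0 ∨ b1 = 1)
    (hb2 : b2 = 0 ∨ b2 = 1)
    (htb3 : tb3 = 0 ∨ tb3 = 1)
    (hacond : a1 * a2 + a2 * tb3 - a1 * tb3 - a2 = 0)
    (hbcond : b1 * b2 + b2 * ta3 - b1 * ta3 - b2 = 0)
    (D : FreeAlgebra K (Fin 3) ⊗[K] FreeAlgebra K (Fin 3) →ₗ[K] FreeAlgebra K (Fin 3) ⊗[K] FreeAlgebra K (Fin 3))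
    (hL : LeibnizRules K (FreeAlgebra K (Fin 3)) D)
    (h11 : D (FreeAlgebra.ι K (0 : Fin 3) ⊗ₜ[K] FreeAlgebra.ι K (0 : Fin 3)) = 0)
    (h22 : D (FreeAlgebra.ι K (1 : Fin 3) ⊗ₜ[K] FreeAlgebra.ι K (1 : Fin 3)) = 0)
    (h33 : D (FreeAlgebra.ι K (2 : Fin 3) ⊗ₜ[K] FreeAlgebra.ι K (2 : Fin 3)) = 0)
    (h12 : D (FreeAlgebra.ι K (0 : Fin 3) ⊗ₜ[K] FreeAlgebra.ι K (1 : Fin 3)) =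
      ta3 • (FreeAlgebra.ι K (0 : Fin 3) ⊗ₜ[K] FreeAlgebra.ι K (1 : Fin 3)) - tb3 • (FreeAlgebra.ι K (1 : Fin 3) ⊗ₜ[K] FreeAlgebra.ι K (0 : Fin 3)))
    (h21 : D (FreeAlgebra.ι K (1 : Fin 3) ⊗ₜ[K] FreeAlgebra.ι K (0 : Fin 3)) =
      (-1 + tb3) • (FreeAlgebra.ι K (0 : Fin 3) ⊗ₜ[K] FreeAlgebra.ι K (1 : Fin 3)) + (1 - ta3) • (FreeAlgebra.ι K (1 : Fin 3) ⊗ₜ[K] FreeAlgebra.ι K (0 : Fin 3)))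
    (h13 : D (FreeAlgebra.ι K (0 : Fin 3) ⊗ₜ[K] FreeAlgebra.ι K (2 : Fin 3)) =
      a2 • ((1 : FreeAlgebra K (Fin 3)) ⊗ₜ[K] (FreeAlgebra.ι K (0 : Fin 3) * FreeAlgebra.ι K (2 : Fin 3))) -
        b2 • ((FreeAlgebra.ι K (2 : Fin 3) * FreeAlgebra.ι K (0 : Fin 3)) ⊗ₜ[K] (1 : FreeAlgebra K (Fin 3))))
    (h31 : D (FreeAlgebra.ι K (2 : Fin 3) ⊗ₜ[K] FreeAlgebra.ι K (0 : Fin 3)) =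
      (-1 + b2) • ((1 : FreeAlgebra K (Fin 3)) ⊗ₜ[K] (FreeAlgebra.ι K (2 : Fin 3) * FreeAlgebra.ι K (0 : Fin 3))) +
        (1 - a2) • ((FreeAlgebra.ι K (0 : Fin 3) * FreeAlgebra.ι K (2 : Fin 3)) ⊗ₜ[K] (1 : FreeAlgebra K (Fin 3))))
    (h23 : D (FreeAlgebra.ι K (1 : Fin 3) ⊗ₜ[K] FreeAlgebra.ι K (2 : Fin 3)) =
      a1 • ((1 : FreeAlgebra K (Fin 3)) ⊗ₜ[K] (FreeAlgebra.ι K (1 : Fin 3) * FreeAlgebra.ι K (2 : Fin 3))) -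
        b1 • ((FreeAlgebra.ι K (2 : Fin 3) * FreeAlgebra.ι K (1 : Fin 3)) ⊗ₜ[K] (1 : FreeAlgebra K (Fin 3))))
    (h32 : D (FreeAlgebra.ι K (2 : Fin 3) ⊗ₜ[K] FreeAlgebra.ι K (1 : Fin 3)) =
      (-1 + b1) • ((1 : FreeAlgebra K (Fin 3)) ⊗ₜ[K] (FreeAlgebra.ι K (2 : Fin 3) * FreeAlgebra.ι K (1 : Fin 3))) +
        (1 - a1) • ((FreeAlgebra.ι K (1 : Fin 3) * FreeAlgebra.ι K (2 : Fin 3)) ⊗ₜ[K] (1 : FreeAlgebra K (Fin 3)))) :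
    IsMixedDoublePoisson K (FreeAlgebra K (Fin 3)) (FreeAlgebra.ι K) ![1, 1, -1] D := by
  
  have hR1 := leibniz_right_one hL
  have hL1 := leibniz_left_one hL
  have hLr := hL.1
  have hLl := hL.2
  have e1 := idem_of_zero_or_one ha1
  have e2 := idem_of_zero_or_one ha2
  have e3 := idem_of_zero_or_one hta3
  have f1 := idem_of_zero_or_one hb1
  have f2 := idem_of_zero_or_one hb2
  have f3 := idem_of_zero_or_one htb3
  clear ha1 ha2 hta3 hb1 hb2 htb3
  have two : (2 : K) ≠ 0 := two_ne_zero
  have c1 : ((1 : K) + 1) / 2 = 1 := by norm_num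
  have c2 : ((1 : K) + -1) / 2 = 0 := by norm_num
  have c3 : ((-1 : K) + 1) / 2 = 0 := by norm_num
  have c4 : ((-1 : K) + -1) / 2 = -1 := by norm_num
  have c5 : ((1 : K) - 1) / 2 = 0 := by norm_num
  have c6 : ((1 : K) - -1) / 2 = 1 := by norm_num
  have c7 : ((-1 : K) - 1) / 2 = -1 := by norm_num
  have c8 : ((-1 : K) - -1) / 2 = 0 := by norm_num
  have l0 : (![1, 1, -1] : Fin 3 → K) 0 = 1 := rfl
  have l1 : (![1, 1, -1] : Fin 3 → K) 1 = 1 := rfl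
  have l2 : (![1, 1, -1] : Fin 3 → K) 2 = -1 := rfl
  generalize FreeAlgebra.ι K = v at *
  refine ⟨⟨hL, ?_⟩, ?_⟩
  · intro i j
    fin_cases i <;> fin_cases j <;>
      simp only [Fin.zero_eta, Fin.mk_one, Fin.reduceFinMk, l0, l1, l2, c1, c2, c3, c4, c5, c6, c7,
        c8, h11, h22, h33, h12, h21, h13, h31, h23, h32, map_add, map_sub, map_smul, map_zero,
        flipT_tmul] <;>
      module
  · intro i j k
    fin_cases i <;> fin_cases j <;> fin_cases k <;>
      simp only [Fin.zero_eta, Fin.mk_one, Fin.reduceFinMk, l0, l1, l2, c1, c2, c3, c4, c5, c6, c7,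
        c8, DJac, h11, h22, h33, h12, h21, h13, h31, h23, h32, map_add, map_sub, map_smul, map_zero,
        dL_tmul, dR_tmul, dLfst_tmul, hLr, hLl, hR1, hL1, mul_add, mul_sub, add_mul, sub_mul,
        mul_zero, zero_mul, mul_smul_comm, smul_mul_assoc, Algebra.TensorProduct.tmul_mul_tmul,
        mul_one, one_mul, TensorProduct.tmul_add, TensorProduct.tmul_sub, TensorProduct.add_tmul,
        TensorProduct.sub_tmul, TensorProduct.tmul_smul, ← TensorProduct.smul_tmul',
        TensorProduct.tmul_zero, TensorProduct.zero_tmul, TensorProduct.assoc_symm_tmul,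
        swap23_tmul, otimes1_tmul, mul_assoc, add_zero, zero_add] <;>
      clear h11 h22 h33 h12 h21 h13 h31 h23 h32 hLr hLl hR1 hL1 hL c1 c2 c3 c4 c5 c6 c7 c8 l0 l1 l2 <;>
      match_scalars <;> grind
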